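/- Holevo bound: let π_1,…,π_n ≥ 0 with Σ_j π_j = 1 and let ρ_1,…,ρ_n be d×d density matrices. Let M_1,…,M_m be positive semidefinite d×d matrices with Σ_a M_a = I_d (a POVM), and let Φ_M(ρ) denote the m×m diagonal matrix with diagonal entries Tr(ρ M_a), a = 1,…,m. Then S(Φ_M(Σ_j π_j ρ_j)) − Σ_j π_j S(Φ_M(ρ_j)) ≤ S(Σ_j π_j ρ_j) − Σ_j π_j S(ρ_j). -/

import Mathlib

open Matrix MeasureTheory
open scoped Kronecker ComplexOrder

/-- Matrix logarithm via spectral decomposition of a Hermitian matrix, with the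
convention `log 0 = 0` on the kernel (i.e. `log` is taken on the support). -/
noncomputable def matLog {n : Type*} [Fintype n] [DecidableEq n] (A : Matrix n n ℂ) :
    Matrix n n ℂ := by
  classical
  exact if hA : A.IsHermitian then
    (hA.eigenvectorUnitary : Matrix n n ℂ) *
      Matrix.diagonal (fun i => (Real.log (hA.eigenvalues i) : ℂ)) *
      ((hA.eigenvectorUnitary : Matrix n n ℂ))ᴴ
  else 0

/-- Quantum relative entropy `H(P,Q) = Tr[P (log P - log Q)]`. -/
noncomputable def relEnt {n : Type*} [Fintype n] [DecidableEq n] (P Q : Matrix n n ℂ) : ℝ :=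
  ((P * (matLog P - matLog Q)).trace).re

/-- Von Neumann entropy `S(ρ) = -Tr[ρ log ρ]`. -/
noncomputable def vNEnt {n : Type*} [Fintype n] [DecidableEq n] (ρ : Matrix n n ℂ) : ℝ :=
  -((ρ * matLog ρ).trace).re

/-- Partial trace over the second tensor factor. -/
noncomputable def ptraceB {A B : Type*} [Fintype B] (M : Matrix (A × B) (A × B) ℂ) :
    Matrix A A ℂ :=
  Matrix.of fun a a' => ∑ b : B, M (a, b) (a', b)


open Filter Topology

/-- Integrating the resolvent-type inequality over `s` yields a relative-entropy inequality. -/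
lemma sum_mul_log_sub_log_nonneg {ι : Type*} [Fintype ι] (w p q : ι → ℝ)
    (hp : ∀ i, 0 ≤ p i) (hsupp : ∀ i, w i * p i ≠ 0 → 0 < q i)
    (hmass : ∑ i, w i * p i = 0)
    (hres : ∀ s, 0 < s → 0 ≤ ∑ i, w i * (p i ^ 2 / (q i + s * p i))) :
    0 ≤ ∑ i, w i * p i * (Real.log (p i) - Real.log (q i)) := by
  have hpos : ∀ i, w i * p i ≠ 0 → 0 < p i := fun i h =>
    lt_of_le_of_ne (hp i) fun h0 => h (by rw [← h0, mul_zero])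
  let G : ℝ → ℝ := fun s => ∑ i, w i * p i * (Real.log (q i + s * p i) - Real.log (q i))
  have hG : ∀ s, 0 ≤ s → HasDerivAt G (∑ i, w i * (p i ^ 2 / (q i + s * p i))) s := by
    intro s hs
    refine HasDerivAt.fun_sum fun i _ => ?_
    by_cases h : w i * p i = 0
    · have h2 : w i * (p i ^ 2 / (q i + s * p i)) = 0 := by
        rw [show w i * (p i ^ 2 / (q i + s * p i)) = (w i * p i) * (p i / (q i + s * p i)) by ring,
          h, zero_mul]
      simpa only [h, h2, zero_mul] using hasDerivAt_const s (0 : ℝ)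
    · have hne : q i + s * p i ≠ 0 := by
        have := hsupp i h
        have := mul_nonneg hs (hp i)
        positivity
      have h1 : HasDerivAt (fun s : ℝ => q i + s * p i) (1 * p i) s :=
        ((hasDerivAt_id s).mul_const (p i)).const_add (q i)
      convert! ((h1.log hne).sub_const (Real.log (q i))).const_mul (w i * p i) using 1
      ring
  have hmono : MonotoneOn G (Set.Ici 0) := by
    refine monotoneOn_of_deriv_nonneg (convex_Ici 0)
      (fun s hs => (hG s hs).continuousAt.continuousWithinAt) ?_ ?_
    · intro s hs
      rw [interior_Ici] at hs
      exact (hG s hs.le).differentiableAt.differentiableWithinAt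
    · intro s hs
      rw [interior_Ici] at hs
      rw [(hG s hs.le).deriv]
      exact hres s hs
  have hG0 : G 0 = 0 := by simp [G]
  have hrescaled : ∀ t, 0 < t →
      0 ≤ ∑ i, w i * p i * (Real.log (q i * t + p i) - Real.log (q i)) := by
    intro t ht
    have h1 : G 0 ≤ G t⁻¹ := hmono (by simp) (by simpa using ht.le) (by positivity)
    rw [hG0] at h1
    have h2 : ∑ i, w i * p i * (Real.log (q i * t + p i) - Real.log (q i))
        = G t⁻¹ + (∑ i, w i * p i) * Real.log t := by
      simp only [G, Finset.sum_mul, ← Finset.sum_add_distrib]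
      refine Finset.sum_congr rfl fun i _ => ?_
      by_cases h : w i * p i = 0
      · simp [h]
      · have hq := hsupp i h
        have hp' := hpos i h
        rw [show q i * t + p i = (q i + t⁻¹ * p i) * t by field_simp,
          Real.log_mul (by positivity) ht.ne']
        ring
    rw [h2, hmass, zero_mul, add_zero]
    exact h1
  have hlim : Tendsto (fun t : ℝ => ∑ i, w i * p i * (Real.log (q i * t + p i) - Real.log (q i)))
      (𝓝[>] 0) (𝓝 (∑ i, w i * p i * (Real.log (p i) - Real.log (q i)))) := by
    refine tendsto_finsetSum _ fun i _ => ?_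
    by_cases h : w i * p i = 0
    · simp [h]
    · have hp' := hpos i h
      have hc : ContinuousAt
          (fun t : ℝ => w i * p i * (Real.log (q i * t + p i) - Real.log (q i))) 0 := by
        have : q i * 0 + p i ≠ 0 := by simpa using hp'.ne'
        fun_prop (disch := assumption)
      have := hc.tendsto
      simp only [mul_zero, zero_add] at this
      exact this.mono_left nhdsWithin_le_nhds
  exact ge_of_tendsto hlim (eventually_nhdsWithin_of_forall hrescaled)

section Spectral

variable {n : Type*} [Fintype n] [DecidableEq n]

lemma Matrix.IsHermitian.eq_eigenvectorUnitary_mul_diagonal {A : Matrix n n ℂ}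
    (hA : A.IsHermitian) :
    A = (hA.eigenvectorUnitary : Matrix n n ℂ) *
      diagonal (fun i => (hA.eigenvalues i : ℂ)) * (hA.eigenvectorUnitary : Matrix n n ℂ)ᴴ :=
  hA.spectral_theorem

lemma Matrix.IsHermitian.matLog_eq {A : Matrix n n ℂ} (hA : A.IsHermitian) :
    matLog A = (hA.eigenvectorUnitary : Matrix n n ℂ) *
      diagonal (fun i => (Real.log (hA.eigenvalues i) : ℂ)) *
      (hA.eigenvectorUnitary : Matrix n n ℂ)ᴴ := by
  simp [matLog, hA]

lemma conjTranspose_mul_self_of_mem_unitaryGroup (U : unitaryGroup n ℂ) :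
    (U : Matrix n n ℂ)ᴴ * (U : Matrix n n ℂ) = 1 := mem_unitaryGroup_iff'.1 U.2

lemma mul_conjTranspose_self_of_mem_unitaryGroup (U : unitaryGroup n ℂ) :
    (U : Matrix n n ℂ) * (U : Matrix n n ℂ)ᴴ = 1 := mem_unitaryGroup_iff.1 U.2

lemma trace_diagonal_mul_mul_diagonal_mul_conjTranspose (f g : n → ℝ) (W : Matrix n n ℂ) :
    (diagonal (fun i => (f i : ℂ)) * W * diagonal (fun i => (g i : ℂ)) * Wᴴ).trace =
      ((∑ i, ∑ j, Complex.normSq (W i j) * (f i * g j) : ℝ) : ℂ) := by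
  simp only [trace, diag_apply, mul_apply (M := _ * diagonal _), mul_diagonal, diagonal_mul,
    conjTranspose_apply]
  push_cast
  refine Finset.sum_congr rfl fun i _ => Finset.sum_congr rfl fun j _ => ?_
  rw [Complex.normSq_eq_conj_mul_self, RCLike.star_def]
  ring

/-- The trace of a product of two matrices diagonalised by the unitaries `U` and `V`. -/
lemma trace_mul_of_diagonalized (U V : unitaryGroup n ℂ) (f g : n → ℝ) :
    ((U * diagonal (fun i => (f i : ℂ)) * (U : Matrix n n ℂ)ᴴ) *
      (V * diagonal (fun i => (g i : ℂ)) * (V : Matrix n n ℂ)ᴴ)).trace =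
      ((∑ i, ∑ j, Complex.normSq (((U : Matrix n n ℂ)ᴴ * V) i j) * (f i * g j) : ℝ) : ℂ) := by
  rw [← trace_diagonal_mul_mul_diagonal_mul_conjTranspose, conjTranspose_mul,
    conjTranspose_conjTranspose]
  simp only [Matrix.mul_assoc]
  rw [trace_mul_comm]
  simp only [Matrix.mul_assoc]

lemma trace_mul_matLog_self {A : Matrix n n ℂ} (hA : A.IsHermitian) :
    (A * matLog A).trace = ((∑ i, hA.eigenvalues i * Real.log (hA.eigenvalues i) : ℝ) : ℂ) := by
  conv_lhs => rw [hA.matLog_eq]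
  nth_rewrite 1 [hA.eq_eigenvectorUnitary_mul_diagonal]
  rw [trace_mul_of_diagonalized, conjTranspose_mul_self_of_mem_unitaryGroup]
  congr 1
  refine Finset.sum_congr rfl fun i _ => ?_
  rw [Finset.sum_eq_single i (fun j _ hj => by simp [one_apply_ne' hj]) (by simp)]
  simp

lemma vNEnt_eq_sum_eigenvalues {A : Matrix n n ℂ} (hA : A.IsHermitian) :
    vNEnt A = -∑ i, hA.eigenvalues i * Real.log (hA.eigenvalues i) := by
  rw [vNEnt, trace_mul_matLog_self hA, Complex.ofReal_re]

lemma vNEnt_diagonal (r : n → ℝ) :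
    vNEnt (diagonal fun i => (r i : ℂ)) = -∑ i, r i * Real.log (r i) := by
  have hA : (diagonal fun i => (r i : ℂ)).IsHermitian := by
    rw [isHermitian_diagonal_iff]
    intro i
    simp [isSelfAdjoint_iff]
  have h := hA.roots_charpoly_eq_eigenvalues
  rw [charpoly_diagonal, Polynomial.roots_prod _ _
    (by simp [Finset.prod_ne_zero_iff, Polynomial.X_sub_C_ne_zero])] at h
  have h2 := congrArg (fun s => (s.map fun z : ℂ => z.re * Real.log z.re).sum) h
  simp only [Polynomial.roots_X_sub_C, Multiset.bind_singleton, Multiset.map_map] at h2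
  rw [vNEnt_eq_sum_eigenvalues hA]
  exact congrArg Neg.neg h2.symm

lemma Matrix.PosSemidef.trace_mul_nonneg {A B : Matrix n n ℂ} (hA : A.PosSemidef)
    (hB : B.PosSemidef) : 0 ≤ (A * B).trace := by
  have h : (A * B).trace = (diagonal (fun i => (hA.1.eigenvalues i : ℂ)) *
      ((hA.1.eigenvectorUnitary : Matrix n n ℂ)ᴴ * B * hA.1.eigenvectorUnitary)).trace := by
    nth_rewrite 1 [hA.1.eq_eigenvectorUnitary_mul_diagonal]
    simp only [Matrix.mul_assoc]
    rw [trace_mul_comm]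
    simp only [Matrix.mul_assoc]
  rw [h]
  simp only [trace, diag_apply, diagonal_mul]
  refine Finset.sum_nonneg fun i _ => mul_nonneg ?_
    (hB.conjTranspose_mul_mul_same (hA.1.eigenvectorUnitary : Matrix n n ℂ)).diag_nonneg
  exact_mod_cast hA.eigenvalues_nonneg i

/-- The square of an average against a POVM is at most the average of the squares. -/
lemma posSemidef_sum_sq_smul_sub_sq {κ : Type*} [Fintype κ] (M : κ → Matrix n n ℂ)
    (hM : ∀ a, (M a).PosSemidef) (hM1 : ∑ a, M a = 1) (x : κ → ℝ) :
    (∑ a, (x a) ^ 2 • M a - (∑ a, x a • M a) * ∑ a, x a • M a).PosSemidef := by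
  set X := ∑ a, x a • M a with hX
  have hXH : Xᴴ = X := by
    simp [hX, conjTranspose_sum, fun a => (hM a).1.eq]
  have h : ∑ a, (x a) ^ 2 • M a - X * X =
      ∑ a, (X - x a • (1 : Matrix n n ℂ))ᴴ * M a * (X - x a • (1 : Matrix n n ℂ)) := by
    have expand : ∀ a, (X - x a • (1 : Matrix n n ℂ))ᴴ * M a * (X - x a • (1 : Matrix n n ℂ)) =
        X * M a * X - X * (x a • M a) - (x a • M a) * X + (x a) ^ 2 • M a := by
      intro a
      simp only [conjTranspose_sub, hXH, conjTranspose_smul, conjTranspose_one, star_trivial,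
        sub_mul, mul_sub, smul_mul_assoc, mul_smul_comm, one_mul, mul_one, smul_sub, smul_smul,
        pow_two]
      abel
    simp only [expand, Finset.sum_add_distrib, Finset.sum_sub_distrib, ← Finset.sum_mul,
      ← Finset.mul_sum, hM1, ← hX, mul_one]
    abel
  rw [h]
  exact posSemidef_sum _ fun a _ => (hM a).conjTranspose_mul_mul_same _

end Spectral

section Measurement

variable {n κ : Type*} [Fintype n] [DecidableEq n] [Fintype κ]

lemma two_mul_re_sub_le_normSq_mul_div {l k : ℝ} (hk : 0 ≤ k) (hkl : k = 0 → l = 0) (w y : ℂ) :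
    2 * (l * (w * y).re) - Complex.normSq y * k ≤ Complex.normSq w * (l ^ 2 / k) := by
  rcases hk.eq_or_lt with h | h
  · simp [← h, hkl h.symm]
  · rw [← mul_div_assoc, le_div_iff₀ h]
    simp only [Complex.mul_re, Complex.normSq_apply]
    nlinarith [sq_nonneg (k * y.re - l * w.re), sq_nonneg (k * y.im + l * w.im)]

/-- Variational lower bound, with Hermitian trial matrix `X`, for the quadratic form of the inverse
of `Y ↦ Q * Y + s • (Y * P)` at `P`. -/
lemma two_mul_trace_sub_le_sum_normSq_mul_div {P Q X : Matrix n n ℂ} (hP : P.PosSemidef)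
    (hQ : Q.PosSemidef) (hX : X.IsHermitian) {s : ℝ} (hs : 0 < s) :
    2 * (P * X).trace.re - (Q * (X * X)).trace.re - s * (P * (X * X)).trace.re ≤
      ∑ i, ∑ j, Complex.normSq (((hP.1.eigenvectorUnitary : Matrix n n ℂ)ᴴ *
        (hQ.1.eigenvectorUnitary : Matrix n n ℂ)) i j) *
        (hP.1.eigenvalues i ^ 2 / (hQ.1.eigenvalues j + s * hP.1.eigenvalues i)) := by
  set U : Matrix n n ℂ := hP.1.eigenvectorUnitary.1 with hU
  set V : Matrix n n ℂ := hQ.1.eigenvectorUnitary.1 with hV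
  set p := hP.1.eigenvalues with hp
  set q := hQ.1.eigenvalues with hq
  have hPe : P = U * diagonal (fun i => (p i : ℂ)) * Uᴴ := hP.1.eq_eigenvectorUnitary_mul_diagonal
  have hQe : Q = V * diagonal (fun i => (q i : ℂ)) * Vᴴ := hQ.1.eq_eigenvectorUnitary_mul_diagonal
  have hUU : U * Uᴴ = 1 := mul_conjTranspose_self_of_mem_unitaryGroup _
  have hVV : V * Vᴴ = 1 := mul_conjTranspose_self_of_mem_unitaryGroup _
  have hp0 : ∀ i, 0 ≤ p i := hP.eigenvalues_nonneg
  have hq0 : ∀ i, 0 ≤ q i := hQ.eigenvalues_nonneg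
  set Y := Vᴴ * X * U with hY
  have hYH : Yᴴ = Uᴴ * X * V := by
    simp [hY, conjTranspose_mul, hX.eq, Matrix.mul_assoc]
  have trace_PX : (P * X).trace.re = ∑ i, ∑ j, p i * ((Uᴴ * V) i j * Y j i).re := by
    have h : (P * X).trace = (diagonal (fun i => (p i : ℂ)) * ((Uᴴ * V) * Y)).trace := by
      have : Uᴴ * V * Y = Uᴴ * X * U := by
        rw [hY, Matrix.mul_assoc Vᴴ, Matrix.mul_assoc Uᴴ, ← Matrix.mul_assoc V, hVV,
          Matrix.one_mul, Matrix.mul_assoc]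
      rw [this, hPe]
      simp only [Matrix.mul_assoc]
      rw [trace_mul_comm]
      simp only [Matrix.mul_assoc]
    rw [h]
    simp only [trace, diag_apply, diagonal_mul, mul_apply (M := Uᴴ * V), Complex.re_sum,
      Complex.re_ofReal_mul, Finset.mul_sum]
  have trace_QXX : (Q * (X * X)).trace.re = ∑ i, ∑ j, Complex.normSq (Y j i) * q j := by
    have h : (Q * (X * X)).trace =
        (diagonal (fun i => (q i : ℂ)) * Y * diagonal (fun _ => ((1 : ℝ) : ℂ)) * Yᴴ).trace := by
      have : Y * Yᴴ = Vᴴ * (X * X) * V := by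
        rw [hYH, hY, Matrix.mul_assoc _ U, Matrix.mul_assoc Uᴴ, ← Matrix.mul_assoc U, hUU]
        simp only [Matrix.one_mul, Matrix.mul_assoc]
      rw [Complex.ofReal_one, diagonal_one, Matrix.mul_one, Matrix.mul_assoc, this, hQe]
      simp only [Matrix.mul_assoc]
      rw [trace_mul_comm]
      simp only [Matrix.mul_assoc]
    rw [h, trace_diagonal_mul_mul_diagonal_mul_conjTranspose (g := fun _ => 1), Complex.ofReal_re,
      Finset.sum_comm]
    simp
  have trace_PXX : (P * (X * X)).trace.re = ∑ i, ∑ j, Complex.normSq (Y j i) * p i := by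
    have h : (P * (X * X)).trace =
        (diagonal (fun i => (p i : ℂ)) * Yᴴ * diagonal (fun _ => ((1 : ℝ) : ℂ)) * Yᴴᴴ).trace := by
      have : Yᴴ * Y = Uᴴ * (X * X) * U := by
        rw [hYH, hY, Matrix.mul_assoc _ V, Matrix.mul_assoc Vᴴ, ← Matrix.mul_assoc V, hVV]
        simp only [Matrix.one_mul, Matrix.mul_assoc]
      rw [Complex.ofReal_one, diagonal_one, Matrix.mul_one, conjTranspose_conjTranspose,
        Matrix.mul_assoc, this, hPe]
      simp only [Matrix.mul_assoc]
      rw [trace_mul_comm]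
      simp only [Matrix.mul_assoc]
    rw [h, trace_diagonal_mul_mul_diagonal_mul_conjTranspose (g := fun _ => 1), Complex.ofReal_re]
    simp [conjTranspose_apply]
  rw [trace_PX, trace_QXX, trace_PXX]
  simp only [Finset.mul_sum, ← Finset.sum_sub_distrib]
  refine Finset.sum_le_sum fun i _ => Finset.sum_le_sum fun j _ => ?_
  have hsp := mul_nonneg hs.le (hp0 i)
  refine le_trans (le_of_eq ?_) (two_mul_re_sub_le_normSq_mul_div (l := p i)
    (add_nonneg (hq0 j) hsp) (fun h => ?_) ((Uᴴ * V) i j) (Y j i))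
  · ring
  · have : s * p i = 0 := by linarith [hq0 j]
    exact (mul_eq_zero.1 this).resolve_left hs.ne'

lemma trace_mul_sum_smul_re (A : Matrix n n ℂ) (M : κ → Matrix n n ℂ) (x : κ → ℝ) :
    (A * ∑ a, x a • M a).trace.re = ∑ a, x a * (A * M a).trace.re := by
  simp [Finset.mul_sum, trace_sum, trace_smul]

lemma sum_sq_div_le_sum_normSq_mul_div {P Q : Matrix n n ℂ} (hP : P.PosSemidef)
    (hQ : Q.PosSemidef) (M : κ → Matrix n n ℂ) (hM : ∀ a, (M a).PosSemidef)
    (hM1 : ∑ a, M a = 1) {s : ℝ} (hs : 0 < s) :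
    ∑ a, (P * M a).trace.re ^ 2 / ((Q * M a).trace.re + s * (P * M a).trace.re) ≤
      ∑ i, ∑ j, Complex.normSq (((hP.1.eigenvectorUnitary : Matrix n n ℂ)ᴴ *
        (hQ.1.eigenvectorUnitary : Matrix n n ℂ)) i j) *
        (hP.1.eigenvalues i ^ 2 / (hQ.1.eigenvalues j + s * hP.1.eigenvalues i)) := by
  let x : κ → ℝ := fun a =>
    (P * M a).trace.re / ((Q * M a).trace.re + s * (P * M a).trace.re)
  have hX : (∑ a, x a • M a).IsHermitian := by
    simp [IsHermitian, conjTranspose_sum, fun a => (hM a).1.eq]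
  have hsq : ∀ A : Matrix n n ℂ, A.PosSemidef →
      (A * ((∑ a, x a • M a) * ∑ a, x a • M a)).trace.re ≤
        ∑ a, x a ^ 2 * (A * M a).trace.re := by
    intro A hA
    have h := (Complex.le_def.1
      (hA.trace_mul_nonneg (posSemidef_sum_sq_smul_sub_sq M hM hM1 x))).1
    rw [mul_sub, trace_sub, Complex.sub_re, trace_mul_sum_smul_re, Complex.zero_re] at h
    linarith
  refine le_trans ?_ (two_mul_trace_sub_le_sum_normSq_mul_div hP hQ hX hs)
  have hPX := mul_le_mul_of_nonneg_left (hsq P hP) hs.le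
  have hterm : ∑ a, (P * M a).trace.re ^ 2 / ((Q * M a).trace.re + s * (P * M a).trace.re) =
      2 * ∑ a, x a * (P * M a).trace.re - ∑ a, x a ^ 2 * (Q * M a).trace.re -
        s * ∑ a, x a ^ 2 * (P * M a).trace.re := by
    simp only [Finset.mul_sum, ← Finset.sum_sub_distrib]
    refine Finset.sum_congr rfl fun a _ => ?_
    simp only [x]
    generalize (P * M a).trace.re = u
    generalize (Q * M a).trace.re = v
    obtain ⟨k, rfl⟩ : ∃ k, v = k - s * u := ⟨v + s * u, by ring⟩
    rw [sub_add_cancel]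
    rcases eq_or_ne k 0 with h | h
    · simp [h]
    · field_simp
      ring
  rw [hterm, trace_mul_sum_smul_re]
  linarith [hsq Q hQ]

/-- Measuring does not increase the relative entropy. -/
lemma sum_trace_mul_log_sub_log_le_relEnt {P Q : Matrix n n ℂ} (hP : P.PosSemidef)
    (hQ : Q.PosSemidef) {c : ℝ} (hc : 0 < c) (hPQ : (Q - c • P).PosSemidef)
    (M : κ → Matrix n n ℂ) (hM : ∀ a, (M a).PosSemidef) (hM1 : ∑ a, M a = 1) :
    ∑ a, (P * M a).trace.re *
      (Real.log (P * M a).trace.re - Real.log (Q * M a).trace.re) ≤ relEnt P Q := by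
  set U := hP.1.eigenvectorUnitary with hU
  set V := hQ.1.eigenvectorUnitary with hV
  set p := hP.1.eigenvalues with hp
  set q := hQ.1.eigenvalues with hq
  set W : n → n → ℝ := fun i j => Complex.normSq (((U : Matrix n n ℂ)ᴴ * V) i j) with hW
  have hPe : P = U * diagonal (fun i => (p i : ℂ)) * (U : Matrix n n ℂ)ᴴ :=
    hP.1.eq_eigenvectorUnitary_mul_diagonal
  have hQe : Q = V * diagonal (fun i => (q i : ℂ)) * (V : Matrix n n ℂ)ᴴ :=
    hQ.1.eq_eigenvectorUnitary_mul_diagonal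
  have hp0 : ∀ i, 0 ≤ p i := hP.eigenvalues_nonneg
  have hq0 : ∀ i, 0 ≤ q i := hQ.eigenvalues_nonneg
  have hW0 : ∀ i j, 0 ≤ W i j := fun i j => Complex.normSq_nonneg _
  have dominated : ∀ B : Matrix n n ℂ, B.PosSemidef →
      c * (P * B).trace.re ≤ (Q * B).trace.re := by
    intro B hB
    have h := (Complex.le_def.1 (hPQ.trace_mul_nonneg hB)).1
    simp only [sub_mul, trace_sub, smul_mul_assoc, trace_smul, Complex.sub_re, Complex.zero_re,
      Complex.real_smul, Complex.re_ofReal_mul] at h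
    linarith
  have trace_P : ∀ g : n → ℝ,
      (P * (V * diagonal (fun i => (g i : ℂ)) * (V : Matrix n n ℂ)ᴴ)).trace.re =
        ∑ i, ∑ j, W i j * (p i * g j) := by
    intro g
    nth_rewrite 1 [hPe]
    rw [trace_mul_of_diagonalized, Complex.ofReal_re]
  have row_sum : ∀ i, ∑ j, W i j = 1 := by
    intro i
    have h : (((U : Matrix n n ℂ)ᴴ * (V : Matrix n n ℂ)) *
        ((U : Matrix n n ℂ)ᴴ * (V : Matrix n n ℂ))ᴴ) i i = 1 := by
      rw [conjTranspose_mul, conjTranspose_conjTranspose, Matrix.mul_assoc,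
        ← Matrix.mul_assoc (V : Matrix n n ℂ), mul_conjTranspose_self_of_mem_unitaryGroup,
        Matrix.one_mul, conjTranspose_mul_self_of_mem_unitaryGroup, one_apply_eq]
    rw [mul_apply] at h
    simp only [conjTranspose_apply, RCLike.star_def, Complex.mul_conj] at h
    exact_mod_cast h
  have supported : ∀ i j, W i j * p i ≠ 0 → 0 < q j := by
    intro i j hij
    have hE : (V * diagonal (fun k => ((Pi.single j 1 : n → ℝ) k : ℂ)) *
        (V : Matrix n n ℂ)ᴴ).PosSemidef := by
      refine PosSemidef.mul_mul_conjTranspose_same (PosSemidef.diagonal fun k => ?_) _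
      by_cases h : k = j
      · subst h; simp
      · simp [h]
    have h := dominated _ hE
    rw [trace_P] at h
    nth_rewrite 1 [hQe] at h
    rw [trace_mul_of_diagonalized, conjTranspose_mul_self_of_mem_unitaryGroup,
      Complex.ofReal_re] at h
    have hr : ∑ i, ∑ k, Complex.normSq ((1 : Matrix n n ℂ) i k) *
        (q i * (Pi.single j 1 : n → ℝ) k) = q j := by
      simp [Pi.single_apply, one_apply, apply_ite]
    have hl : W i j * p i ≤ ∑ i, ∑ k, W i k * (p i * (Pi.single j 1 : n → ℝ) k) := by
      simp only [Pi.single_apply, mul_ite, mul_one, mul_zero, Finset.sum_ite_eq',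
        Finset.mem_univ, if_true]
      exact Finset.single_le_sum (f := fun i => W i j * p i)
        (fun i _ => mul_nonneg (hW0 i j) (hp0 i)) (Finset.mem_univ i)
    rw [hr] at h
    have hpos : 0 < W i j * p i := lt_of_le_of_ne (mul_nonneg (hW0 i j) (hp0 i)) hij.symm
    exact lt_of_lt_of_le (mul_pos hc (hpos.trans_le hl)) h
  have hPM : ∀ a, 0 ≤ (P * M a).trace.re := fun a =>
    (Complex.le_def.1 (hP.trace_mul_nonneg (hM a))).1
  have trace_eq : (P.trace).re = ∑ i, p i := by
    simpa using congrArg Complex.re hP.1.trace_eq_sum_eigenvalues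
  have relEnt_eq : relEnt P Q =
      ∑ i, ∑ j, W i j * p i * (Real.log (p i) - Real.log (q j)) := by
    rw [relEnt, mul_sub, trace_sub, Complex.sub_re, trace_mul_matLog_self hP.1, hQ.1.matLog_eq,
      trace_P (fun j => Real.log (q j)), Complex.ofReal_re, ← Finset.sum_sub_distrib]
    refine Finset.sum_congr rfl fun i _ => ?_
    rw [← one_mul (hP.1.eigenvalues i * _), ← row_sum i, Finset.sum_mul,
      ← Finset.sum_sub_distrib]
    exact Finset.sum_congr rfl fun j _ => by ring
  have key := sum_mul_log_sub_log_nonneg (ι := (n × n) ⊕ κ)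
    (Sum.elim (fun k => W k.1 k.2) fun _ => -1)
    (Sum.elim (fun k => p k.1) fun a => (P * M a).trace.re)
    (Sum.elim (fun k => q k.2) fun a => (Q * M a).trace.re)
    (by rintro (k | a)
        · exact hp0 _
        · exact hPM a)
    (by rintro (k | a) h
        · exact supported _ _ h
        · simp only [Sum.elim_inr, neg_mul, one_mul, ne_eq, neg_eq_zero] at h ⊢
          exact (mul_pos hc (lt_of_le_of_ne (hPM a) (Ne.symm h))).trans_le (dominated _ (hM a)))
    (by simp only [Fintype.sum_sum_type, Sum.elim_inl, Sum.elim_inr, Fintype.sum_prod_type,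
          ← Finset.sum_mul, row_sum, ← Finset.mul_sum, ← Complex.re_sum, ← trace_sum, hM1]
        simp [trace_eq])
    (by intro s hs
        have := sum_sq_div_le_sum_normSq_mul_div hP hQ M hM hM1 hs
        simp only [Fintype.sum_sum_type, Sum.elim_inl, Sum.elim_inr, Fintype.sum_prod_type,
          ← Finset.mul_sum]
        linarith)
  simp only [Fintype.sum_sum_type, Sum.elim_inl, Sum.elim_inr, Fintype.sum_prod_type,
    neg_mul, one_mul, Finset.sum_neg_distrib] at key
  rw [relEnt_eq]
  linarith

end Measurement

/-- The Holevo bound: for a POVM `{Mₐ}` with measurement map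
`Φ_M(ρ) = diag(Tr(ρ M₁), …, Tr(ρ Mₘ))`,
`χ(Φ_M(ℰ)) ≤ χ(ℰ)` for every ensemble `ℰ = {πⱼ, ρⱼ}`. -/
theorem holevo_bound {d n m : ℕ}
    (π : Fin n → ℝ) (hπ : ∀ j, 0 ≤ π j) (hπ1 : ∑ j, π j = 1)
    (ρ : Fin n → Matrix (Fin d) (Fin d) ℂ)
    (hρ : ∀ j, (ρ j).PosSemidef) (hρ1 : ∀ j, (ρ j).trace = 1)
    (M : Fin m → Matrix (Fin d) (Fin d) ℂ)
    (hM : ∀ a, (M a).PosSemidef) (hM1 : ∑ a, M a = 1) :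
    vNEnt (Matrix.diagonal fun a => ((∑ j, π j • ρ j) * M a).trace) -
        ∑ j, π j * vNEnt (Matrix.diagonal fun a => (ρ j * M a).trace) ≤
      vNEnt (∑ j, π j • ρ j) - ∑ j, π j * vNEnt (ρ j) := by
  set σ := ∑ j, π j • ρ j with hσ
  have hσpsd : σ.PosSemidef := posSemidef_sum _ fun j _ => (hρ j).smul (hπ j)
  have measured : ∀ A : Matrix (Fin d) (Fin d) ℂ, A.PosSemidef →
      vNEnt (diagonal fun a => (A * M a).trace) =
        -∑ a, (A * M a).trace.re * Real.log (A * M a).trace.re := by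
    intro A hA
    rw [← vNEnt_diagonal]
    congr 2 with a
    exact Complex.eq_re_of_ofReal_le (r := 0) (by simpa using hA.trace_mul_nonneg (hM a))
  have trace_σ : ∀ B : Matrix (Fin d) (Fin d) ℂ,
      (σ * B).trace.re = ∑ j, π j * (ρ j * B).trace.re := by
    intro B
    simp [hσ, Finset.sum_mul, trace_sum, trace_smul]
  have monotone : ∀ j, π j * ∑ a, (ρ j * M a).trace.re *
      (Real.log (ρ j * M a).trace.re - Real.log (σ * M a).trace.re) ≤ π j * relEnt (ρ j) σ := by
    intro j
    rcases (hπ j).eq_or_lt with h | h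
    · simp [← h]
    · refine mul_le_mul_of_nonneg_left (sum_trace_mul_log_sub_log_le_relEnt (hρ j) hσpsd h ?_ M hM
        hM1) (hπ j)
      rw [hσ, ← Finset.add_sum_erase _ _ (Finset.mem_univ j), add_sub_cancel_left]
      exact posSemidef_sum _ fun k _ => (hρ k).smul (hπ k)
  have hsum := Finset.sum_le_sum fun j (_ : j ∈ Finset.univ) => monotone j
  have quantum : ∑ j, π j * relEnt (ρ j) σ = vNEnt σ - ∑ j, π j * vNEnt (ρ j) := by
    simp only [vNEnt, relEnt, trace_σ, mul_sub, trace_sub, Complex.sub_re, Finset.sum_sub_distrib,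
      mul_neg, Finset.sum_neg_distrib]
    ring
  have classical : ∑ j, π j * ∑ a, (ρ j * M a).trace.re *
      (Real.log (ρ j * M a).trace.re - Real.log (σ * M a).trace.re) =
      vNEnt (diagonal fun a => (σ * M a).trace) -
        ∑ j, π j * vNEnt (diagonal fun a => (ρ j * M a).trace) := by
    have h : ∑ a, (σ * M a).trace.re * Real.log (σ * M a).trace.re =
        ∑ j, π j * ∑ a, (ρ j * M a).trace.re * Real.log (σ * M a).trace.re := by
      simp only [Finset.mul_sum]
      rw [Finset.sum_comm]
      refine Finset.sum_congr rfl fun a _ => ?_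
      nth_rewrite 1 [trace_σ]
      rw [Finset.sum_mul]
      exact Finset.sum_congr rfl fun j _ => mul_assoc _ _ _
    simp only [measured σ hσpsd, fun j => measured (ρ j) (hρ j), h, mul_sub,
      Finset.sum_sub_distrib, mul_neg, Finset.sum_neg_distrib]
    ring
  rw [← quantum, ← classical]
  exact hsum
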